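/- Let n ≥ 1 and let m be a nonnegative integer. Then, as an identity of rational functions in ℚ(x_1,…,x_n), the Schur polynomial s_{(m^n)} in the 2n variables (x_1, x_1^{−1}, …, x_{n−1}, x_{n−1}^{−1}, x_n, 1) equals the sum of the intermediate symplectic characters sp^{(n−1,1)}_λ(x_1,…,x_{n−1} | x_n) over all partitions λ ∈ Par((m^n)). -/

import Mathlib

open Matrix BigOperators
open scoped Classical

noncomputable section

/-- The field `ℚ(t_1, …, t_n)` of rational functions in `n` indeterminates over `ℚ`. -/
abbrev FF (n : ℕ) : Type := FractionRing (MvPolynomial (Fin n) ℚ)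

/-- The `i`-th indeterminate, viewed as an element of `FF n`. -/
def gen (n : ℕ) (i : Fin n) : FF n :=
  algebraMap (MvPolynomial (Fin n) ℚ) (FF n) (MvPolynomial.X i)

variable {F : Type*} [Field F]

/-- Symplectic character `sp_λ(z_1, …, z_N)` for an integer weight `μ`. -/
def spP {N : ℕ} (z : Fin N → F) (μ : Fin N → ℤ) : F :=
  Matrix.det (Matrix.of fun i j : Fin N =>
      z j ^ (μ i + (N : ℤ) - (i : ℕ)) - z j ^ (-(μ i + (N : ℤ) - (i : ℕ)))) /
  Matrix.det (Matrix.of fun i j : Fin N =>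
      z j ^ ((N : ℤ) - (i : ℕ)) - z j ^ (-((N : ℤ) - (i : ℕ))))

/-- The matrix `Ā_λ` of the bialternant formula for the intermediate symplectic character
`sp^{(k, N-k)}` with integer weight `μ`. -/
def interMatP {N : ℕ} (k : ℕ) (z : Fin N → F) (μ : Fin N → ℤ) : Matrix (Fin N) (Fin N) F :=
  Matrix.of fun i j : Fin N =>
    if (j : ℕ) < k then
      z j ^ (μ i + (k : ℤ) - (i : ℕ)) /
          ∏ l ∈ Finset.univ.filter (fun l : Fin N => k ≤ (l : ℕ)), (1 - (z j)⁻¹ * z l) -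
        z j ^ (-(μ i + (k : ℤ) - (i : ℕ))) /
          ∏ l ∈ Finset.univ.filter (fun l : Fin N => k ≤ (l : ℕ)), (1 - z j * z l)
    else z j ^ (μ i + (N : ℤ) - 1 - (i : ℕ))

/-- Intermediate symplectic character `sp^{(k, N-k)}_μ(z_1, …, z_k | z_{k+1}, …, z_N)`
for an integer weight `μ`. -/
def spInterP {N : ℕ} (k : ℕ) (z : Fin N → F) (μ : Fin N → ℤ) : F :=
  (interMatP k z μ).det / (interMatP k z fun _ => 0).det

/-- Schur function `s_μ(z_1, …, z_N)` as a ratio of alternants (bialternant formula). -/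
def schurP {N : ℕ} (z : Fin N → F) (μ : Fin N → ℤ) : F :=
  Matrix.det (Matrix.of fun i j : Fin N => z j ^ (μ i + (N : ℤ) - 1 - (i : ℕ))) /
  Matrix.det (Matrix.of fun i j : Fin N => z j ^ ((N : ℤ) - 1 - (i : ℕ)))

/-- The determinant is expanded along a decomposition of each column into two summands. -/
theorem det_sum_bool_columns {n : ℕ} (f : Fin n → Bool → Fin n → F) :
    det (of fun i j => ∑ b, f j b i) =
      ∑ β : Fin n → Bool, det (of fun i j => f j (β j) i) := by
  have h := (detRowAlternating (R := F) (n := Fin n)).toMultilinearMap.map_sum f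
  have e : det (of fun i j => ∑ b, f j b i) = det (of fun j : Fin n => ∑ b, f j b) := by
    rw [← det_transpose]
    congr 1
  rw [e]
  refine h.trans (Finset.sum_congr rfl fun β _ => ?_)
  exact (det_transpose (of fun j i => f j (β j) i)).symm

/-- A variant of `det_sum_bool_columns` in which the last column is left alone. -/
theorem det_sum_bool_columns_last {N : ℕ} (f : Fin N → Bool → Fin (N + 1) → F)
    (v : Fin (N + 1) → F) :
    det (of fun i j => Fin.lastCases (motive := fun _ => F) (v i) (fun j' => ∑ b, f j' b i) j) =
      ∑ β : Fin N → Bool, det (of fun i j =>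
        Fin.lastCases (motive := fun _ => F) (v i) (fun j' => f j' (β j') i) j) := by
  let g : Fin (N + 1) → Bool → Fin (N + 1) → F :=
    fun j b i => Fin.lastCases (motive := fun _ => F) (if b then v i else 0) (fun j' => f j' b i) j
  have h := det_sum_bool_columns g
  have e : (of fun i j => ∑ b, g j b i) =
      of fun i j => Fin.lastCases (motive := fun _ => F) (v i) (fun j' => ∑ b, f j' b i) j := by
    ext i j
    refine Fin.lastCases ?_ (fun j => ?_) j <;> simp [g]
  rw [e] at h
  rw [h, ← (Fin.snocEquiv fun _ : Fin (N + 1) => Bool).sum_comp, Fintype.sum_prod_type]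
  have h0 : ∑ β : Fin N → Bool, det (of fun i j => g j (Fin.snocEquiv (fun _ => Bool) (false, β) j) i)
      = 0 := by
    refine Finset.sum_eq_zero fun β _ => det_eq_zero_of_column_eq_zero (Fin.last N) fun i => ?_
    simp [g, Fin.snocEquiv]
  rw [Fintype.sum_bool, h0, add_zero]
  refine Finset.sum_congr rfl fun β _ => ?_
  congr 1
  ext i j
  refine Fin.lastCases ?_ (fun j => ?_) j <;> simp [g, Fin.snocEquiv]

/-- A Vandermonde determinant whose top row is prepended by the values of a polynomial. -/
theorem det_cons_eval_vandermonde {k : ℕ} (g : Polynomial F) (hg : g.natDegree ≤ k)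
    (u : Fin (k + 1) → F) :
    det (of fun i j => Fin.cases (motive := fun _ => F) (g.eval (u j))
      (fun i' : Fin k => u j ^ (i' : ℕ)) i) =
      (-1) ^ k * g.coeff k * det (of fun i j : Fin (k + 1) => u j ^ (i : ℕ)) := by
  let C : Matrix (Fin (k + 1)) (Fin (k + 1)) F :=
    of fun i l => Fin.cases (motive := fun _ => F) (g.coeff (l : ℕ))
      (fun i' : Fin k => if (l : ℕ) = i' then 1 else 0) i
  have hC : C.det = (-1) ^ k * g.coeff k := by
    rw [det_succ_column _ (Fin.last k), Fin.sum_univ_succ]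
    have h1 : C.submatrix (Fin.succAbove 0) (Fin.succAbove (Fin.last k)) = 1 := by
      ext i l
      simp [C, one_apply, Fin.ext_iff, eq_comm]
    rw [h1]
    simp only [C, of_apply, Fin.cases_zero, Fin.cases_succ, Fin.val_last]
    rw [Finset.sum_eq_zero]
    · simp
    · intro i _
      rw [if_neg (by have := i.isLt; omega)]
      simp
  have hM : (of fun i j => Fin.cases (motive := fun _ => F) (g.eval (u j))
      (fun i' : Fin k => u j ^ (i' : ℕ)) i) = C * of fun i j : Fin (k + 1) => u j ^ (i : ℕ) := by
    ext i j
    rw [mul_apply]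
    refine Fin.cases ?_ (fun i' => ?_) i
    · simp only [C, of_apply, Fin.cases_zero]
      rw [Polynomial.eval_eq_sum_range' (Nat.lt_succ_of_le hg), Finset.sum_range]
    · simp only [C, of_apply, Fin.cases_succ, ite_mul, one_mul, zero_mul]
      rw [Finset.sum_eq_single i'.castSucc]
      · simp
      · intro b _ hb
        rw [if_neg]
        intro h
        exact hb (Fin.ext h)
      · simp
  rw [hM, det_mul, hC]

/-- The determinant of `q_j y_j^{n-1-i} - y_j^i`. -/
def pairAlt {n : ℕ} (q y : Fin n → F) : F :=
  det (of fun i j : Fin n => q j * y j ^ (n - 1 - (i : ℕ)) - y j ^ (i : ℕ))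

theorem pairAlt_eq_sum {k : ℕ} (q y : Fin (k + 1) → F) (hy : ∀ j, y j ≠ 0) :
    pairAlt q y = ∑ β : Fin (k + 1) → Bool,
      (∏ j, if β j then q j * y j ^ k else -1) *
        det (of fun i j : Fin (k + 1) => (if β j then (y j)⁻¹ else y j) ^ (i : ℕ)) := by
  have h := det_sum_bool_columns (n := k + 1) (F := F) fun j b i =>
    (if b then q j * y j ^ k else -1) * (if b then (y j)⁻¹ else y j) ^ (i : ℕ)
  have e : pairAlt q y = det (of fun i j : Fin (k + 1) => ∑ b : Bool,
      (if b then q j * y j ^ k else -1) * (if b then (y j)⁻¹ else y j) ^ (i : ℕ)) := by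
    unfold pairAlt
    congr 1
    ext i j
    simp only [of_apply, Fintype.sum_bool, if_true, Bool.false_eq_true, if_false, inv_pow]
    rw [sub_eq_add_neg, neg_one_mul]
    congr 1
    have : y j ^ (i : ℕ) ≠ 0 := pow_ne_zero _ (hy j)
    rw [show k + 1 - 1 - (i : ℕ) = k - i by omega]
    rw [← pow_sub_mul_pow (y j) (show (i : ℕ) ≤ k by omega)]
    field_simp
  rw [e, h]
  refine Finset.sum_congr rfl fun β _ => ?_
  exact det_mul_row _ _

theorem exists_interpolating_poly {n : ℕ} (y : Fin (n + 1) → F) (hy : ∀ j, y j ≠ 0)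
    (hy' : ∀ j, y j ≠ -1) (β : Fin (n + 1) → Bool) :
    ∃ g : Polynomial F, g.natDegree ≤ n ∧
      g.coeff n = (-1) ^ n * ((∏ j, if β j then y j else 1) - 1) *
        (∏ j, if β j then y j else 1) ∧
      (∀ j, β j = false → g.eval (y j) = 0) ∧
      ∀ j, β j = true → g.eval (y j)⁻¹ * y j ^ n =
        y j * ((y j - 1) * ∏ k, (y j * y (j.succAbove k) - 1)) := by
  set Y := ∏ j, if β j then y j else 1 with hY
  let P₁ : Polynomial F := ∏ j, (Polynomial.C (y j) - Polynomial.X)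
  let P₂ : Polynomial F := ∏ j,
    (Polynomial.C (if β j then 1 else y j) - Polynomial.C (if β j then y j else 1) * Polynomial.X)
  let A : Polynomial F := Polynomial.C Y + Polynomial.C (Y - 1) * Polynomial.X
  let G : Polynomial F := P₁ - A * P₂
  have hP₂0 : Y * ∏ j, (if β j then 1 else y j) = ∏ j, y j := by
    rw [hY, ← Finset.prod_mul_distrib]
    refine Finset.prod_congr rfl fun j _ => ?_
    split_ifs <;> simp
  have eP₁ : ∀ t, P₁.eval t = ∏ j, (y j - t) := fun t => by
    simp [P₁, Polynomial.eval_prod]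
  have eP₂ : ∀ t, P₂.eval t = ∏ j, ((if β j then 1 else y j) - (if β j then y j else 1) * t) :=
    fun t => by simp [P₂, Polynomial.eval_prod]
  have eA : ∀ t, A.eval t = Y + (Y - 1) * t := fun t => by simp [A]
  have eG : ∀ t, G.eval t = P₁.eval t - A.eval t * P₂.eval t := fun t => by simp [G]
  have hG0 : G.eval 0 = 0 := by
    rw [eG, eP₁, eP₂, eA]
    simp [hP₂0]
  have hG1 : G.eval (-1) = 0 := by
    rw [eG, eP₁, eP₂, eA]
    have : ∀ j, ((if β j then 1 else y j) - (if β j then y j else 1) * (-1)) = y j - -1 := by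
      intro j
      split_ifs <;> ring
    simp only [this]
    ring
  obtain ⟨g₁, hg₁⟩ := Polynomial.dvd_iff_isRoot.mpr (show G.IsRoot 0 from hG0)
  have hg₁0 : g₁.eval (-1) = 0 := by
    have := hG1
    rw [hg₁] at this
    simpa using this
  obtain ⟨g, hg⟩ := Polynomial.dvd_iff_isRoot.mpr (show g₁.IsRoot (-1) from hg₁0)
  have hGg : G = (Polynomial.X * (Polynomial.X + 1)) * g := by
    rw [hg₁, hg]
    simp [mul_assoc]
  have hmon : (Polynomial.X * (Polynomial.X + 1) : Polynomial F).Monic :=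
    Polynomial.monic_X.mul (Polynomial.monic_X_add_C 1)
  have hdeg2 : (Polynomial.X * (Polynomial.X + 1) : Polynomial F).natDegree = 2 := by
    have h1 := Polynomial.natDegree_X_add_C (1 : F)
    have h2 := Polynomial.monic_X_add_C (1 : F)
    rw [Polynomial.C_1] at h1 h2
    rw [Polynomial.Monic.natDegree_mul Polynomial.monic_X h2, h1, Polynomial.natDegree_X]
  have d1 : P₁.natDegree ≤ n + 1 := by
    refine (Polynomial.natDegree_prod_le _ _).trans ?_
    refine (Finset.sum_le_card_nsmul _ _ 1 fun j _ => ?_).trans (by simp)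
    compute_degree
  have d2' : ∀ j, (Polynomial.C (if β j then 1 else y j) -
      Polynomial.C (if β j then y j else 1) * Polynomial.X : Polynomial F).natDegree ≤ 1 :=
    fun j => by compute_degree
  have d2 : P₂.natDegree ≤ n + 1 := by
    refine (Polynomial.natDegree_prod_le _ _).trans ?_
    exact (Finset.sum_le_card_nsmul _ _ 1 fun j _ => d2' j).trans (by simp)
  have dA : A.natDegree ≤ 1 := by simp only [A]; compute_degree
  have dG : G.natDegree ≤ n + 2 := by
    refine (Polynomial.natDegree_sub_le _ _).trans (max_le (by omega) ?_)
    exact Polynomial.natDegree_mul_le.trans (by omega)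
  have dg : g.natDegree ≤ n := by
    by_cases h0 : g = 0
    · simp [h0]
    · have := hmon.natDegree_mul' h0
      rw [← hGg, hdeg2] at this
      omega
  have cP₂ : P₂.coeff (n + 1) = (-1) ^ (n + 1) * Y := by
    have := Polynomial.coeff_prod_of_natDegree_le (s := Finset.univ)
      (fun j => (Polynomial.C (if β j then 1 else y j) -
      Polynomial.C (if β j then y j else 1) * Polynomial.X : Polynomial F)) 1 (fun j _ => d2' j)
    simp only [Finset.card_univ, Fintype.card_fin, mul_one] at this
    rw [this, hY]
    have e : ∀ j, (Polynomial.C (if β j then 1 else y j) -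
      Polynomial.C (if β j then y j else 1) * Polynomial.X : Polynomial F).coeff 1
        = (-1) * (if β j then y j else 1) := by
      intro j
      split_ifs <;> simp [Polynomial.coeff_C, Polynomial.coeff_one]
    simp only [e, Finset.prod_mul_distrib]
    simp
  have cG : G.coeff (n + 2) = g.coeff n := by
    rw [hGg, show n + 2 = 2 + n by omega,
      Polynomial.coeff_mul_add_eq_of_natDegree_le hdeg2.le dg]
    have := hmon.coeff_natDegree
    rw [hdeg2] at this
    rw [this, one_mul]
  have cG' : G.coeff (n + 2) = -((Y - 1) * ((-1) ^ (n + 1) * Y)) := by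
    simp only [G, Polynomial.coeff_sub]
    rw [Polynomial.coeff_eq_zero_of_natDegree_lt (lt_of_le_of_lt d1 (by omega)),
      show n + 2 = 1 + (n + 1) by omega, Polynomial.coeff_mul_add_eq_of_natDegree_le dA d2, cP₂]
    simp [A, Polynomial.coeff_C]
  have egt : ∀ t, t * (t + 1) * g.eval t = G.eval t := fun t => by simp [hGg]
  refine ⟨g, dg, ?_, ?_, ?_⟩
  · rw [← cG, cG', pow_succ]
    ring
  · intro j hj
    have h := egt (y j)
    rw [eG, eP₁, eP₂, Finset.prod_eq_zero (Finset.mem_univ j) (sub_self (y j)),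
      Finset.prod_eq_zero (Finset.mem_univ j) (by simp [hj])] at h
    simp only [mul_zero, sub_zero, mul_eq_zero] at h
    rcases h with (h | h) | h
    · exact absurd h (hy j)
    · exact absurd (eq_neg_of_add_eq_zero_left h) (hy' j)
    · exact h
  · intro j hj
    have h := egt (y j)⁻¹
    rw [eG, eP₁, eP₂, Finset.prod_eq_zero (f := fun k => (if β k then 1 else y k) -
      (if β k then y k else 1) * (y j)⁻¹) (Finset.mem_univ j) (by simp [hj, hy j])] at h
    have h2 : (∏ k, (y k - (y j)⁻¹)) * y j ^ (n + 1) =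
        (y j * y j - 1) * ∏ k, (y j * y (j.succAbove k) - 1) := by
      rw [← Fin.prod_univ_succAbove (fun k => y j * y k - 1) j]
      have : y j ^ (n + 1) = ∏ _k : Fin (n + 1), y j := by simp
      rw [this, ← Finset.prod_mul_distrib]
      refine Finset.prod_congr rfl fun k _ => ?_
      have := hy j
      field_simp
    rw [mul_zero, sub_zero] at h
    rw [← h] at h2
    have hne : y j + 1 ≠ 0 := fun h => hy' j (eq_neg_of_add_eq_zero_left h)
    have hj0 := hy j
    apply mul_left_cancel₀ hne
    have h3 : (y j + 1) * (g.eval (y j)⁻¹ * y j ^ n) =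
        y j * ((y j)⁻¹ * ((y j)⁻¹ + 1) * g.eval (y j)⁻¹ * y j ^ (n + 1)) := by
      rw [pow_succ]
      field_simp
      ring
    rw [h3, h2]
    ring

/-- The recurrence in `q` of `pairAlt`. -/
theorem pairAlt_mul_sub {n : ℕ} (q y : Fin (n + 1) → F) (hy : ∀ j, y j ≠ 0)
    (hy' : ∀ j, y j ≠ -1) :
    pairAlt (fun j => y j * q j) y - pairAlt q y =
      ∑ j : Fin (n + 1), (-1) ^ (j : ℕ) *
        (q j * ((y j - 1) * ∏ k, (y j * y (j.succAbove k) - 1))) *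
        pairAlt (fun k => q (j.succAbove k)) (fun k => y (j.succAbove k)) := by
  rcases n with _ | n
  · simp [pairAlt]
    ring
  set w : Fin (n + 2) → F := fun j => (y j - 1) * ∏ k, (y j * y (j.succAbove k) - 1) with hw
  let R : Fin (n + 2) → Bool → Fin (n + 2) → F := fun j b i =>
    Fin.cases (motive := fun _ => F) (if b then q j * w j else 0)
      (fun i' : Fin (n + 1) => if b then q j * y j ^ (n - (i' : ℕ)) else -y j ^ (i' : ℕ)) i
  have hR : ∑ j : Fin (n + 2), (-1) ^ (j : ℕ) * (q j * w j) *
        pairAlt (fun k => q (j.succAbove k)) (fun k => y (j.succAbove k)) =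
      det (of fun i j => ∑ b, R j b i) := by
    rw [det_succ_row_zero]
    refine Finset.sum_congr rfl fun j _ => ?_
    unfold pairAlt
    congr 1
    · simp [R]
    · congr 1
      ext i k
      simp [R, sub_eq_add_neg]
  rw [hR, det_sum_bool_columns, pairAlt_eq_sum _ _ hy, pairAlt_eq_sum _ _ hy,
    ← Finset.sum_sub_distrib]
  refine Finset.sum_congr rfl fun β _ => ?_
  obtain ⟨g, dg, cg, g0, g1⟩ := exists_interpolating_poly y hy hy' β
  set Y := ∏ j, if β j then y j else 1 with hY
  have hY0 : Y ≠ 0 := Finset.prod_ne_zero_iff.mpr fun j _ => by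
    split_ifs
    · exact hy j
    · exact one_ne_zero
  have e1 : det (of fun i j => R j (β j) i) =
      (∏ j, if β j then q j * y j ^ n else -1) *
        det (of fun i j => Fin.cases (motive := fun _ => F)
          (g.eval (if β j then (y j)⁻¹ else y j))
          (fun i' : Fin (n + 1) => (if β j then (y j)⁻¹ else y j) ^ (i' : ℕ)) i) := by
    rw [← det_mul_row]
    congr 1
    ext i j
    refine Fin.cases ?_ (fun i' => ?_) i
    · simp only [R, of_apply, Fin.cases_zero]
      by_cases hb : β j = true
      · have := g1 j hb
        simp only [hb, if_true]
        have h0 := hy j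
        rw [pow_succ] at this
        have h2 : g.eval (y j)⁻¹ * y j ^ n = w j := by
          apply mul_left_cancel₀ h0
          rw [← this]
          ring
        rw [← h2]
        ring
      · simp [hb, g0 j (by simpa using hb)]
    · simp only [R, of_apply, Fin.cases_succ]
      by_cases hb : β j = true
      · simp only [hb, if_true, inv_pow]
        have h0 : y j ^ (i' : ℕ) ≠ 0 := pow_ne_zero _ (hy j)
        rw [← pow_sub_mul_pow (y j) (show (i' : ℕ) ≤ n by omega)]
        field_simp
      · simp [hb]
  rw [e1, det_cons_eval_vandermonde g dg, cg]
  have p1 : (∏ j, if β j then y j * q j * y j ^ (n + 1) else -1) =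
      Y * (Y * ∏ j, if β j then q j * y j ^ n else -1) := by
    rw [hY, ← Finset.prod_mul_distrib, ← Finset.prod_mul_distrib]
    refine Finset.prod_congr rfl fun j _ => ?_
    split_ifs <;> ring
  have p2 : (∏ j, if β j then q j * y j ^ (n + 1) else -1) =
      Y * ∏ j, if β j then q j * y j ^ n else -1 := by
    rw [hY, ← Finset.prod_mul_distrib]
    refine Finset.prod_congr rfl fun j _ => ?_
    split_ifs <;> ring
  rw [p1, p2]
  have s : ((-1 : F) ^ (n + 1)) * (-1) ^ (n + 1) = 1 := by
    rw [← mul_pow]; simp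
  linear_combination (-(Y - 1) * Y * (∏ j, if β j then q j * y j ^ n else -1) *
    det (of fun i j : Fin (n + 2) => (if β j then (y j)⁻¹ else y j) ^ (i : ℕ))) * s

/-- Partitions with at most `n` parts, all of them smaller than `p`. -/
def boxPartitions (n p : ℕ) : Finset (Fin n → ℕ) :=
  (Fintype.piFinset fun _ : Fin n => Finset.range p).filter Antitone

theorem mem_boxPartitions {n p : ℕ} {lam : Fin n → ℕ} :
    lam ∈ boxPartitions n p ↔ (∀ i, lam i < p) ∧ Antitone lam := by
  simp [boxPartitions]

theorem sum_filter_antitone_fin {n p : ℕ} (g : (Fin n → ℕ) → F) :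
    ∑ lam ∈ Finset.univ.filter (fun lam : Fin n → Fin p => Antitone fun i => (lam i : ℕ)),
      g (fun i => (lam i : ℕ)) = ∑ lam ∈ boxPartitions n p, g lam := by
  refine Finset.sum_bij (fun lam _ i => (lam i : ℕ)) ?_ ?_ ?_ ?_
  · intro lam h
    exact mem_boxPartitions.mpr ⟨fun i => (lam i).isLt, (Finset.mem_filter.mp h).2⟩
  · intro a _ b _ h
    funext i
    exact Fin.ext (congrFun h i)
  · intro b hb
    obtain ⟨h1, h2⟩ := mem_boxPartitions.mp hb
    exact ⟨fun i => ⟨b i, h1 i⟩, by simpa using h2, rfl⟩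
  · intro _ _
    rfl

theorem sum_boxPartitions_succ_succ {n p : ℕ} (g : (Fin (n + 1) → ℕ) → F) :
    ∑ lam ∈ boxPartitions (n + 1) (p + 1), g lam =
      ∑ lam ∈ boxPartitions (n + 1) p, g lam +
        ∑ lam ∈ boxPartitions n (p + 1), g (Fin.cons p lam) := by
  rw [← Finset.sum_filter_not_add_sum_filter _ (fun lam : Fin (n + 1) → ℕ => lam 0 = p)]
  congr 1
  · refine Finset.sum_congr ?_ fun _ _ => rfl
    ext lam
    simp only [Finset.mem_filter, mem_boxPartitions]
    constructor
    · rintro ⟨⟨h1, h2⟩, h3⟩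
      refine ⟨fun i => ?_, h2⟩
      have := h2 (Fin.zero_le i)
      have := h1 0
      omega
    · rintro ⟨h1, h2⟩
      exact ⟨⟨fun i => (h1 i).trans (Nat.lt_succ_self p), h2⟩, (h1 0).ne⟩
  · refine Finset.sum_nbij' Fin.tail (fun lam => Fin.cons p lam) ?_ ?_ ?_ ?_ ?_
    · intro lam h
      simp only [Finset.mem_filter, mem_boxPartitions] at h ⊢
      exact ⟨fun i => h.1.1 _, fun i j hij => h.1.2 (Fin.succ_le_succ_iff.mpr hij)⟩
    · intro lam h
      simp only [Finset.mem_filter, mem_boxPartitions] at h ⊢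
      refine ⟨⟨fun i => ?_, fun i j hij => ?_⟩, Fin.cons_zero _ _⟩
      · refine Fin.cases ?_ (fun i => ?_) i
        · simp
        · simpa using h.1 i
      · revert hij
        refine Fin.cases ?_ (fun j => ?_) j
        · intro hij
          rw [Fin.le_zero_iff.mp hij]
        · refine Fin.cases ?_ (fun i => ?_) i
          · intro _
            simpa using Nat.lt_succ_iff.mp (h.1 j)
          · intro hij
            simpa using h.2 (Fin.succ_le_succ_iff.mp hij)
    · intro lam h
      rw [← (Finset.mem_filter.mp h).2]
      exact Fin.cons_self_tail lam
    · intro lam _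
      exact Fin.tail_cons _ _
    · intro lam h
      rw [← (Finset.mem_filter.mp h).2, Fin.cons_self_tail]

/-- The sum of the Schur alternants over all partitions in a box. -/
def alternantSum (n p : ℕ) (y : Fin n → F) : F :=
  ∑ lam ∈ boxPartitions n p, det (of fun i j => y j ^ (lam i + (n - 1 - (i : ℕ))))

theorem alternantSum_succ_succ (n p : ℕ) (y : Fin (n + 1) → F) :
    alternantSum (n + 1) (p + 1) y = alternantSum (n + 1) p y +
      ∑ j : Fin (n + 1), (-1) ^ (j : ℕ) * y j ^ (p + n) *
        alternantSum n (p + 1) (fun k => y (j.succAbove k)) := by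
  unfold alternantSum
  rw [sum_boxPartitions_succ_succ]
  congr 1
  simp only [Finset.mul_sum]
  rw [Finset.sum_comm]
  refine Finset.sum_congr rfl fun lam _ => ?_
  rw [det_succ_row_zero]
  refine Finset.sum_congr rfl fun j _ => ?_
  congr 1
  congr 1
  ext i k
  simp only [submatrix_apply, of_apply, Fin.cons_succ, Fin.val_succ]
  congr 2
  omega

/-- The product of `c i j` over all pairs `i < j`. -/
def pairProd {n : ℕ} (c : Fin n → Fin n → F) : F :=
  ∏ i, ∏ j, if i < j then c i j else 1

theorem pairProd_succAbove {n : ℕ} (c : Fin (n + 1) → Fin (n + 1) → F)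
    (hc : ∀ i j, c i j = c j i) (j : Fin (n + 1)) :
    pairProd c = (∏ k, c j (j.succAbove k)) *
      pairProd fun i k => c (j.succAbove i) (j.succAbove k) := by
  unfold pairProd
  rw [Fin.prod_univ_succAbove _ j]
  simp only [Fin.prod_univ_succAbove _ j, lt_irrefl, if_false, one_mul,
    Finset.prod_mul_distrib, Fin.succAbove_lt_succAbove_iff]
  rw [← mul_assoc, ← Finset.prod_mul_distrib]
  congr 1
  refine Finset.prod_congr rfl fun k _ => ?_
  rcases lt_or_gt_of_ne (Fin.ne_succAbove j k) with h | h
  · rw [if_pos h, if_neg (lt_asymm h), mul_one]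
  · rw [if_neg (lt_asymm h), if_pos h, one_mul, hc]

theorem pairProd_snoc {n : ℕ} (c : Fin (n + 1) → Fin (n + 1) → F) :
    pairProd c = pairProd (fun i j : Fin n => c i.castSucc j.castSucc) *
      ∏ i : Fin n, c i.castSucc (Fin.last n) := by
  unfold pairProd
  have h : ∀ i : Fin n, ¬ Fin.last n < i.castSucc := fun i => not_lt.mpr (Fin.le_last _)
  simp [Fin.prod_univ_castSucc, Finset.prod_mul_distrib, Fin.castSucc_lt_last, h]

theorem pairProd_mul {n : ℕ} (c d : Fin n → Fin n → F) :
    pairProd (fun i j => c i j * d i j) = pairProd c * pairProd d := by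
  unfold pairProd
  simp only [← Finset.prod_mul_distrib]
  refine Finset.prod_congr rfl fun i _ => Finset.prod_congr rfl fun j _ => ?_
  split_ifs <;> simp

theorem pairProd_ne_zero {n : ℕ} {c : Fin n → Fin n → F} (h : ∀ i j, i < j → c i j ≠ 0) :
    pairProd c ≠ 0 := by
  refine Finset.prod_ne_zero_iff.mpr fun i _ => Finset.prod_ne_zero_iff.mpr fun j _ => ?_
  split_ifs with hij
  · exact h i j hij
  · exact one_ne_zero

theorem pairProd_congr {n : ℕ} {c d : Fin n → Fin n → F} (h : ∀ i j, i < j → c i j = d i j) :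
    pairProd c = pairProd d := by
  refine Finset.prod_congr rfl fun i _ => Finset.prod_congr rfl fun j _ => ?_
  split_ifs with hij
  · exact h i j hij
  · rfl

theorem det_pow_eq_pairProd {n : ℕ} (v : Fin n → F) :
    det (of fun i j : Fin n => v j ^ (i : ℕ)) = pairProd fun i j => v j - v i := by
  rw [← det_transpose]
  refine (det_vandermonde v).trans ?_
  unfold pairProd
  refine Finset.prod_congr rfl fun i _ => ?_
  rw [← Finset.prod_filter]
  refine Finset.prod_congr ?_ fun _ _ => rfl
  ext j
  simp

/-- The denominator in Macdonald's bounded Littlewood identity. -/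
def littlewoodDenom {n : ℕ} (y : Fin n → F) : F :=
  (∏ j, (y j - 1)) * pairProd fun i j => y i * y j - 1

theorem littlewoodDenom_succAbove {n : ℕ} (y : Fin (n + 1) → F) (j : Fin (n + 1)) :
    littlewoodDenom y = ((y j - 1) * ∏ k, (y j * y (j.succAbove k) - 1)) *
      littlewoodDenom fun k => y (j.succAbove k) := by
  unfold littlewoodDenom
  rw [pairProd_succAbove _ (fun i j => by rw [mul_comm]) j, Fin.prod_univ_succAbove _ j]
  ring

/-- Macdonald's bounded Littlewood identity. -/
theorem alternantSum_mul_littlewoodDenom : ∀ (n p : ℕ) (y : Fin n → F), (∀ j, y j ≠ 0) →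
    (∀ j, y j ≠ -1) →
    alternantSum n p y * littlewoodDenom y = pairAlt (fun j => y j ^ (p + n - 1)) y
  | 0, p, y, _, _ => by
    have : boxPartitions 0 p = {0} := by
      ext lam
      simp [mem_boxPartitions, Subsingleton.elim lam 0, Subsingleton.antitone]
    simp [alternantSum, this, littlewoodDenom, pairAlt, pairProd]
  | n + 1, 0, y, _, _ => by
    have : boxPartitions (n + 1) 0 = ∅ := by
      ext lam
      simp [mem_boxPartitions]
    rw [alternantSum, this]
    simp only [Finset.sum_empty, zero_mul, zero_add, Nat.add_sub_cancel]
    refine (det_eq_zero_of_row_eq_zero (Fin.last n) fun j => ?_).symm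
    simp
  | n + 1, p + 1, y, h0, h1 => by
    have ih := alternantSum_mul_littlewoodDenom (n + 1) p y h0 h1
    have h := pairAlt_mul_sub (fun j => y j ^ (p + n)) y h0 h1
    have e1 : p + 1 + (n + 1) - 1 = p + n + 1 := by omega
    have e2 : p + (n + 1) - 1 = p + n := by omega
    simp only [← pow_succ'] at h
    rw [e1, sub_eq_iff_eq_add.mp h, alternantSum_succ_succ, add_mul, ih, e2, add_comm,
      Finset.sum_mul]
    congr 1
    refine Finset.sum_congr rfl fun j _ => ?_
    have ihj := alternantSum_mul_littlewoodDenom n (p + 1) (fun k => y (j.succAbove k))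
      (fun k => h0 _) (fun k => h1 _)
    rw [show p + 1 + n - 1 = p + n by omega] at ihj
    rw [← ihj, littlewoodDenom_succAbove y j]
    ring
  termination_by n p => n + p

/-- The type `C`-like alternant with rows `x^{-i} - x^{-(W-i)}`. -/
def invAlt {N : ℕ} (W : ℕ) (x : Fin N → F) : F :=
  det (of fun i j : Fin N => (x j)⁻¹ ^ (i : ℕ) - (x j)⁻¹ ^ (W - (i : ℕ)))

theorem det_interMatP {N : ℕ} (z : Fin (N + 1) → F) (lam : Fin (N + 1) → ℕ) :
    (interMatP N z fun i => (lam i : ℤ)).det = ∑ β : Fin N → Bool,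
      (∏ j : Fin N, if β j then (1 - (z j.castSucc)⁻¹ * z (Fin.last N))⁻¹
        else -(1 - z j.castSucc * z (Fin.last N))⁻¹) *
      det (of fun i j => (Fin.snoc (α := fun _ => F)
        (fun j' : Fin N => if β j' then z j'.castSucc else (z j'.castSucc)⁻¹)
        (z (Fin.last N)) j) ^ (lam i + (N + 1 - 1 - (i : ℕ)))) := by
  have hf : (Finset.univ.filter fun l : Fin (N + 1) => N ≤ (l : ℕ)) = {Fin.last N} := by
    ext l
    simp only [Finset.mem_filter, Finset.mem_univ, true_and, Finset.mem_singleton, Fin.ext_iff,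
      Fin.val_last]
    omega
  have h := det_sum_bool_columns_last (N := N) (F := F) (fun j b i =>
    (if b then (1 - (z j.castSucc)⁻¹ * z (Fin.last N))⁻¹
        else -(1 - z j.castSucc * z (Fin.last N))⁻¹) *
      (if b then z j.castSucc else (z j.castSucc)⁻¹) ^ (lam i + (N + 1 - 1 - (i : ℕ))))
    (fun i => z (Fin.last N) ^ (lam i + (N + 1 - 1 - (i : ℕ))))
  have e : (interMatP N z fun i => (lam i : ℤ)) = of fun i j =>
      Fin.lastCases (motive := fun _ => F) (z (Fin.last N) ^ (lam i + (N + 1 - 1 - (i : ℕ))))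
      (fun j' : Fin N => ∑ b : Bool, (if b then (1 - (z j'.castSucc)⁻¹ * z (Fin.last N))⁻¹
        else -(1 - z j'.castSucc * z (Fin.last N))⁻¹) *
      (if b then z j'.castSucc else (z j'.castSucc)⁻¹) ^ (lam i + (N + 1 - 1 - (i : ℕ)))) j := by
    ext i j
    have hi : (lam i : ℤ) + (N : ℤ) - ((i : ℕ) : ℤ) = ((lam i + (N + 1 - 1 - (i : ℕ)) : ℕ) : ℤ) := by
      have := i.isLt
      omega
    have hi' : (lam i : ℤ) + ((N + 1 : ℕ) : ℤ) - 1 - ((i : ℕ) : ℤ) =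
        ((lam i + (N + 1 - 1 - (i : ℕ)) : ℕ) : ℤ) := by
      have := i.isLt
      omega
    simp only [interMatP, of_apply, hf, Finset.prod_singleton, hi, hi', _root_.zpow_neg,
      zpow_natCast]
    refine Fin.lastCases ?_ (fun j' => ?_) j
    · simp
    · simp [div_eq_mul_inv, sub_eq_add_neg, mul_comm]
  rw [e, h]
  refine Finset.sum_congr rfl fun β _ => ?_
  let c : Fin (N + 1) → F := Fin.snoc (α := fun _ => F) (fun j : Fin N =>
    if β j then (1 - (z j.castSucc)⁻¹ * z (Fin.last N))⁻¹
        else -(1 - z j.castSucc * z (Fin.last N))⁻¹) 1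
  have hc : (∏ j : Fin N, if β j then (1 - (z j.castSucc)⁻¹ * z (Fin.last N))⁻¹
        else -(1 - z j.castSucc * z (Fin.last N))⁻¹) = ∏ j, c j := by
    simp [c, Fin.prod_univ_castSucc]
  rw [hc, ← det_mul_row]
  congr 1
  ext i j
  refine Fin.lastCases ?_ (fun j' => ?_) j
  · simp [c]
  · simp [c]

theorem pairAlt_snoc_inv {N p : ℕ} (x : Fin N → F) (y : F) (hx : ∀ j, x j ≠ 0)
    (β : Fin N → Bool) :
    pairAlt (fun j => (Fin.snoc (α := fun _ => F) (fun j' : Fin N =>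
      if β j' then x j' else (x j')⁻¹) y j : F) ^ (p + N))
      (Fin.snoc (α := fun _ => F) (fun j' : Fin N => if β j' then x j' else (x j')⁻¹) y) =
    (∏ j : Fin N, if β j then 1 else -((x j)⁻¹ ^ (p + 2 * N))) *
      pairAlt (fun j => (Fin.snoc (α := fun _ => F) x y j : F) ^ (p + N))
        (Fin.snoc (α := fun _ => F) x y) := by
  let c : Fin (N + 1) → F := Fin.snoc (α := fun _ => F)
    (fun j : Fin N => if β j then 1 else -((x j)⁻¹ ^ (p + 2 * N))) 1
  have hc : (∏ j : Fin N, if β j then 1 else -((x j)⁻¹ ^ (p + 2 * N))) = ∏ j, c j := by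
    simp [c, Fin.prod_univ_castSucc]
  rw [hc]
  unfold pairAlt
  rw [← det_mul_row]
  congr 1
  ext i j
  refine Fin.lastCases ?_ (fun j => ?_) j
  · simp [c]
  · have hi : (i : ℕ) ≤ N := Nat.lt_succ_iff.mp i.isLt
    simp only [c, of_apply, Fin.snoc_castSucc, Nat.add_sub_cancel, ← pow_add]
    by_cases hb : β j = true
    · simp [hb]
    · have h0 := hx j
      obtain ⟨d, hd⟩ := Nat.exists_eq_add_of_le hi
      simp only [hb, if_false, Bool.false_eq_true]
      have e1 : p + N + (N - (i : ℕ)) = p + (i : ℕ) + 2 * d := by omega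
      have e2 : p + 2 * N = p + 2 * (i : ℕ) + 2 * d := by omega
      rw [e1, e2]
      simp only [inv_pow]
      field_simp
      ring

/-- Signed sum over all ways of inverting the variables. -/
theorem sum_inverted_pairProd {N W : ℕ} (hW : 2 * N ≤ W + 1) (x : Fin N → F) (hx : ∀ j, x j ≠ 0) :
    ∑ β : Fin N → Bool, (∏ j, if β j then 1 else -((x j)⁻¹ ^ W)) *
      pairProd (fun i j => (if β j then (x j)⁻¹ else x j) - (if β i then (x i)⁻¹ else x i)) =
      invAlt W x := by
  have h := det_sum_bool_columns (n := N) (F := F) fun j b i =>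
    (if b then 1 else -((x j)⁻¹ ^ W)) * (if b then (x j)⁻¹ else x j) ^ (i : ℕ)
  have e : invAlt W x = det (of fun i j : Fin N => ∑ b : Bool,
      (if b then 1 else -((x j)⁻¹ ^ W)) * (if b then (x j)⁻¹ else x j) ^ (i : ℕ)) := by
    unfold invAlt
    congr 1
    ext i j
    have h0 := hx j
    simp only [of_apply, Fintype.sum_bool, if_true, Bool.false_eq_true, if_false, one_mul]
    rw [sub_eq_add_neg]
    congr 1
    rw [← pow_sub_mul_pow (x j)⁻¹ (show (i : ℕ) ≤ W by omega)]
    have h1 : (x j)⁻¹ ^ (i : ℕ) * x j ^ (i : ℕ) = 1 := by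
      rw [← mul_pow, inv_mul_cancel₀ h0, one_pow]
    linear_combination ((x j)⁻¹ ^ (W - (i : ℕ))) * h1
  rw [e, h]
  refine Finset.sum_congr rfl fun β _ => ?_
  rw [← det_pow_eq_pairProd]
  exact (det_mul_row _ _).symm

/-- The intermediate symplectic alternants, summed over a box. -/
theorem sum_det_interMatP {N : ℕ} (z : Fin (N + 1) → F) (h0 : ∀ j, z j ≠ 0) (h1 : ∀ j, z j ≠ 1)
    (h2 : ∀ j, z j ≠ -1) (h3 : ∀ i j, i ≠ j → z i ≠ z j) (h4 : ∀ i j, i ≠ j → z i * z j ≠ 1) :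
    ∃ κ : F, κ ≠ 0 ∧ ∀ p : ℕ, 1 ≤ p →
      ∑ lam ∈ boxPartitions (N + 1) p, (interMatP N z fun i => (lam i : ℤ)).det =
        κ * (pairAlt (fun j => z j ^ (p + N)) z *
          invAlt (p + 2 * N - 1) fun j : Fin N => z j.castSucc) := by
  set x : Fin N → F := fun j => z j.castSucc with hx
  set y := z (Fin.last N) with hy
  have hz : Fin.snoc (α := fun _ => F) x y = z := Fin.snoc_init_self z
  have x0 : ∀ j, x j ≠ 0 := fun j => h0 _
  have x1 : ∀ j, x j ≠ 1 := fun j => h1 _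
  have x2 : ∀ j, x j ≠ -1 := fun j => h2 _
  have xy : ∀ j, x j ≠ y := fun j => h3 _ _ (Fin.castSucc_lt_last j).ne
  have xy' : ∀ j, x j * y ≠ 1 := fun j => h4 _ _ (Fin.castSucc_lt_last j).ne
  have xx : ∀ i j, i < j → x i ≠ x j := fun i j h =>
    h3 _ _ (Fin.castSucc_lt_castSucc_iff.mpr h).ne
  have xx' : ∀ i j, i < j → x i * x j ≠ 1 := fun i j h =>
    h4 _ _ (Fin.castSucc_lt_castSucc_iff.mpr h).ne
  have y1 : y - 1 ≠ 0 := sub_ne_zero.mpr (h1 _)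
  let κ₁ : Fin N → F := fun j => -((x j - 1) * (1 - (x j)⁻¹ * y) * (1 - x j * y))⁻¹
  let Δ : Fin N → Fin N → F := fun i j => x i + (x i)⁻¹ - x j - (x j)⁻¹
  have k1 : ∀ j, x j - 1 ≠ 0 := fun j => sub_ne_zero.mpr (x1 j)
  have k2 : ∀ j, 1 - (x j)⁻¹ * y ≠ 0 := fun j h => xy j (by
    have h' := x0 j
    field_simp at h
    linear_combination h)
  have k3 : ∀ j, 1 - x j * y ≠ 0 := fun j => sub_ne_zero.mpr (xy' j).symm
  have hΔ : ∀ i j, i < j → Δ i j ≠ 0 := fun i j hij h => by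
    have e : Δ i j = (x i - x j) * (x i * x j - 1) * (x i)⁻¹ * (x j)⁻¹ := by
      have := x0 i
      have := x0 j
      simp only [Δ]
      field_simp
      ring
    rw [e] at h
    simp [x0, sub_ne_zero.mpr (xx i j hij), sub_ne_zero.mpr (xx' i j hij)] at h
  refine ⟨(∏ j, κ₁ j) * ((y - 1) * pairProd Δ)⁻¹, ?_, fun p hp => ?_⟩
  · refine mul_ne_zero (Finset.prod_ne_zero_iff.mpr fun j _ => ?_)
      (inv_ne_zero (mul_ne_zero y1 (pairProd_ne_zero hΔ)))
    exact neg_ne_zero.mpr (inv_ne_zero (mul_ne_zero (mul_ne_zero (k1 j) (k2 j)) (k3 j)))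
  rw [← sum_inverted_pairProd (by omega) x x0]
  simp only [det_interMatP, ← hy]
  rw [Finset.sum_comm, Finset.mul_sum, Finset.mul_sum]
  refine Finset.sum_congr rfl fun β _ => ?_
  rw [← Finset.mul_sum]
  set u : Fin N → F := fun j => if β j then x j else (x j)⁻¹ with hu
  change (∏ j, if β j then (1 - (x j)⁻¹ * y)⁻¹ else -(1 - x j * y)⁻¹) *
    alternantSum (N + 1) p (Fin.snoc (α := fun _ => F) u y) = _
  have u0 : ∀ j, u j ≠ 0 := fun j => by
    simp only [hu]
    split_ifs <;> simp [x0]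
  have u2 : ∀ j, u j ≠ -1 := fun j h => by
    simp only [hu] at h
    split_ifs at h
    · exact x2 j h
    · exact x2 j (by rw [← inv_inv (x j), h]; norm_num)
  have u1 : ∀ j, u j - 1 ≠ 0 := fun j h => by
    simp only [hu] at h
    split_ifs at h
    · exact k1 j h
    · exact x1 j (by rw [← inv_inv (x j), sub_eq_zero.mp h]; norm_num)
  have uy : ∀ j, u j * y - 1 ≠ 0 := fun j h => by
    simp only [hu] at h
    split_ifs at h
    · exact k3 j (by linear_combination -h)
    · exact k2 j (by linear_combination -h)
  have M := alternantSum_mul_littlewoodDenom (N + 1) p (Fin.snoc (α := fun _ => F) u y)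
    (fun j => by
      refine Fin.lastCases ?_ (fun j => ?_) j
      · rw [Fin.snoc_last]; exact h0 _
      · rw [Fin.snoc_castSucc]; exact u0 j)
    (fun j => by
      refine Fin.lastCases ?_ (fun j => ?_) j
      · rw [Fin.snoc_last]; exact h2 _
      · rw [Fin.snoc_castSucc]; exact u2 j)
  rw [show p + (N + 1) - 1 = p + N by omega, pairAlt_snoc_inv x y x0 β, hz] at M
  have hden : littlewoodDenom (Fin.snoc (α := fun _ => F) u y) =
      (∏ j, (u j - 1) * (u j * y - 1)) * ((y - 1) * pairProd fun i j => u i * u j - 1) := by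
    unfold littlewoodDenom
    rw [pairProd_snoc]
    simp only [Fin.prod_univ_castSucc, Fin.snoc_castSucc, Fin.snoc_last, Finset.prod_mul_distrib]
    ring
  have hP : pairProd Δ = (pairProd fun i j => u i * u j - 1) *
      pairProd fun i j => (if β j then (x j)⁻¹ else x j) - (if β i then (x i)⁻¹ else x i) := by
    rw [← pairProd_mul]
    refine pairProd_congr fun i j _ => ?_
    have := x0 i
    have := x0 j
    simp only [hu, Δ]
    split_ifs <;> field_simp <;> ring
  have hc : (∏ j, if β j then (1 - (x j)⁻¹ * y)⁻¹ else -(1 - x j * y)⁻¹) *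
      (∏ j, if β j then 1 else -((x j)⁻¹ ^ (p + 2 * N))) =
      (∏ j, κ₁ j) * (∏ j, if β j then 1 else -((x j)⁻¹ ^ (p + 2 * N - 1))) *
        ∏ j, (u j - 1) * (u j * y - 1) := by
    simp only [← Finset.prod_mul_distrib]
    refine Finset.prod_congr rfl fun j _ => ?_
    have a0 := x0 j
    have a1 := k1 j
    have a2 := k2 j
    have a3 := k3 j
    have e : (x j)⁻¹ ^ (p + 2 * N) = (x j)⁻¹ ^ (p + 2 * N - 1) * (x j)⁻¹ := by
      rw [← pow_succ]
      congr 1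
      omega
    rw [e]
    simp only [κ₁, hu]
    split_ifs
    · rw [show x j * y - 1 = -(1 - x j * y) by ring]
      generalize 1 - (x j)⁻¹ * y = a at *
      generalize 1 - x j * y = b at *
      field_simp
    · rw [show (x j)⁻¹ * y - 1 = -(1 - (x j)⁻¹ * y) by ring,
        show (x j)⁻¹ - 1 = -(x j - 1) * (x j)⁻¹ by field_simp; ring]
      generalize 1 - (x j)⁻¹ * y = a at *
      generalize 1 - x j * y = b at *
      generalize (x j)⁻¹ ^ (p + 2 * N - 1) = e
      field_simp
  have d1 : (∏ j, (u j - 1) * (u j * y - 1)) ≠ 0 :=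
    Finset.prod_ne_zero_iff.mpr fun j _ => mul_ne_zero (u1 j) (uy j)
  have d3 := pairProd_ne_zero hΔ
  have d2 : (pairProd fun i j => u i * u j - 1) ≠ 0 := fun h => d3 (by rw [hP, h, zero_mul])
  rw [hden] at M
  rw [eq_div_of_mul_eq (mul_ne_zero d1 (mul_ne_zero y1 d2)) M]
  set P := pairProd fun i j => (if β j then (x j)⁻¹ else x j) - (if β i then (x i)⁻¹ else x i)
  set Q := pairProd fun i j => u i * u j - 1
  have d4 : P ≠ 0 := fun h => d3 (by rw [hP, h, mul_zero])
  rw [← mul_div_assoc, ← mul_assoc, hc, hP]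
  generalize (∏ j, (u j - 1) * (u j * y - 1)) = D at *
  generalize (∏ j, κ₁ j) = K
  field_simp

theorem det_invAlt_border {N W : ℕ} (hW : 2 * N + 1 ≤ W) (x : Fin N → F) (hx : ∀ j, x j ≠ 0) :
    det (of fun i j : Fin (N + 1) => Fin.lastCases (motive := fun _ => F) 1
      (fun j' : Fin N => x j' ^ (i : ℕ) * (x j')⁻¹ ^ W + (x j')⁻¹ ^ (i : ℕ)) j) =
      ((-1) ^ N * ∏ j, ((x j)⁻¹ - 1)) * invAlt (W - 1) x := by
  let A : Matrix (Fin (N + 1)) (Fin (N + 1)) F :=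
    of fun i j => Fin.lastCases (motive := fun _ => F) 1
      (fun j' : Fin N => x j' ^ (i : ℕ) * (x j')⁻¹ ^ W + (x j')⁻¹ ^ (i : ℕ)) j
  let B : Matrix (Fin (N + 1)) (Fin (N + 1)) F :=
    of fun i j => Fin.cases (motive := fun _ => F) (A 0 j)
      (fun i' : Fin N => A i'.succ j - A i'.castSucc j) i
  have hAB : A.det = B.det := by
    refine det_eq_of_forall_row_eq_smul_add_pred (fun _ => 1) (fun j => ?_) (fun i j => ?_)
    · simp [B]
    · simp [B]
  change A.det = _
  rw [hAB, det_succ_column _ (Fin.last N), Fin.sum_univ_succ, Finset.sum_eq_zero]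
  · have e : B.submatrix (Fin.succAbove 0) (Fin.succAbove (Fin.last N)) =
        of fun i j : Fin N => ((x j)⁻¹ - 1) *
          (of fun i j : Fin N => (x j)⁻¹ ^ (i : ℕ) - (x j)⁻¹ ^ (W - 1 - (i : ℕ))) i j := by
      ext i j
      have h0 := hx j
      obtain ⟨d, hd⟩ := Nat.exists_eq_add_of_le (show 2 * (i : ℕ) + 1 ≤ W by omega)
      have e1 : W - 1 - (i : ℕ) = i + d := by omega
      simp only [B, A, submatrix_apply, of_apply, Fin.succAbove_zero, Fin.succAbove_last,
        Fin.cases_succ, Fin.lastCases_castSucc, Fin.val_succ, Fin.val_castSucc, e1]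
      rw [hd]
      simp only [inv_pow]
      field_simp
      ring
    rw [e, det_mul_row]
    simp [B, A, invAlt]
    ring
  · intro i _
    simp [B, A]

theorem det_fromBlocks_pairs {N W : ℕ} (hW : 2 * N + 1 ≤ W) (z : Fin (N + 1) → F)
    (hz : ∀ j, z j ≠ 0) (z' : Fin (N + 1) → F) (hz' : ∀ j : Fin N, z' j.castSucc = (z j.castSucc)⁻¹)
    (hl : z' (Fin.last N) = 1) :
    det (fromBlocks (of fun i j : Fin (N + 1) => z j ^ (W - (i : ℕ)))
      (of fun i j : Fin (N + 1) => z' j ^ (W - (i : ℕ)))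
      (of fun i j : Fin (N + 1) => z j ^ (i : ℕ))
      (of fun i j : Fin (N + 1) => z' j ^ (i : ℕ))) =
    det (of fun i j : Fin (N + 1) => z j ^ (W - (i : ℕ)) - z j ^ (i : ℕ)) *
      (((-1) ^ N * ∏ j : Fin N, ((z j.castSucc)⁻¹ - 1)) *
        invAlt (W - 1) fun j : Fin N => z j.castSucc) := by
  set A : Matrix (Fin (N + 1)) (Fin (N + 1)) F := of fun i j => z j ^ (W - (i : ℕ)) with hA
  set B : Matrix (Fin (N + 1)) (Fin (N + 1)) F := of fun i j => z' j ^ (W - (i : ℕ)) with hB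
  set C : Matrix (Fin (N + 1)) (Fin (N + 1)) F := of fun i j => z j ^ (i : ℕ) with hC
  set D : Matrix (Fin (N + 1)) (Fin (N + 1)) F := of fun i j => z' j ^ (i : ℕ) with hD
  let v : Fin (N + 1) → F := fun j => Fin.lastCases (motive := fun _ => F) 0
    (fun j' : Fin N => (z j'.castSucc)⁻¹ ^ W) j
  have h1 : fromBlocks 1 (-1) 0 1 * fromBlocks A B C D * fromBlocks 1 (diagonal v) 0 1 =
      fromBlocks (A - C) 0 C (C * diagonal v + D) := by
    rw [fromBlocks_multiply, fromBlocks_multiply]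
    congr 1
    · simp [sub_eq_add_neg]
    · ext i j
      simp only [Matrix.one_mul, Matrix.neg_mul, Matrix.mul_one, Matrix.add_apply,
        Matrix.neg_apply, mul_diagonal, Matrix.zero_apply]
      refine Fin.lastCases ?_ (fun j => ?_) j
      · simp [v, hB, hD, hl]
      · have h0 := hz j.castSucc
        obtain ⟨d, hd⟩ := Nat.exists_eq_add_of_le (show 2 * (i : ℕ) ≤ W by omega)
        have e1 : W - (i : ℕ) = i + d := by omega
        simp only [v, hA, hB, hC, hD, of_apply, hz', Fin.lastCases_castSucc, e1, inv_pow]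
        rw [hd]
        field_simp
        ring
    · simp
    · simp
  have h2 := congrArg det h1
  rw [det_mul, det_mul, det_fromBlocks_zero₂₁, det_fromBlocks_zero₂₁, det_fromBlocks_zero₁₂] at h2
  simp only [det_one, one_mul, mul_one] at h2
  rw [h2, ← det_invAlt_border hW _ fun j => hz _]
  congr 2
  ext i j
  refine Fin.lastCases ?_ (fun j => ?_) j
  · simp [v, hC, hD, hl]
  · simp [v, hC, hD, hz']

/-- The alternant of a rectangle, in `N` pairs of mutually inverse variables and two more. -/
theorem exists_rectangle_alternant {N : ℕ} (z : Fin (N + 1) → F) (hz : ∀ j, z j ≠ 0)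
    (hz1 : ∀ j, z j ≠ 1) (ζ : Fin (2 * (N + 1)) → F)
    (he : ∀ j : Fin (N + 1), ζ ⟨2 * j, by omega⟩ = z j)
    (ho : ∀ j : Fin N, ζ ⟨2 * j + 1, by omega⟩ = (z j.castSucc)⁻¹)
    (hl : ζ ⟨2 * N + 1, by omega⟩ = 1) :
    ∃ c : F, c ≠ 0 ∧ ∀ m : ℕ,
      det (of fun i j : Fin (2 * (N + 1)) =>
        ζ j ^ ((if (i : ℕ) < N + 1 then (m : ℤ) else 0) + ((2 * (N + 1) : ℕ) : ℤ) - 1 - (i : ℕ))) =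
      c * (pairAlt (fun j => z j ^ (m + 1 + N)) z *
        invAlt (m + 1 + 2 * N - 1) fun j : Fin N => z j.castSucc) := by
  let r : Fin (N + 1) ⊕ Fin (N + 1) → Fin (2 * (N + 1)) :=
    Sum.elim (fun i => ⟨i, by omega⟩) (fun i => ⟨2 * N + 1 - i, by omega⟩)
  let s : Fin (N + 1) ⊕ Fin (N + 1) → Fin (2 * (N + 1)) :=
    Sum.elim (fun i => ⟨2 * i, by omega⟩) (fun i => ⟨2 * i + 1, by omega⟩)
  have hcard : Fintype.card (Fin (N + 1) ⊕ Fin (N + 1)) = Fintype.card (Fin (2 * (N + 1))) := by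
    simp
    omega
  have hr : Function.Bijective r := by
    rw [Fintype.bijective_iff_injective_and_card]
    refine ⟨?_, hcard⟩
    rintro (i | i) (j | j) h <;> simp only [r, Sum.elim_inl, Sum.elim_inr, Fin.mk.injEq] at h
    · exact congrArg _ (Fin.ext h)
    · omega
    · omega
    · exact congrArg _ (Fin.ext (by omega))
  have hs : Function.Bijective s := by
    rw [Fintype.bijective_iff_injective_and_card]
    refine ⟨?_, hcard⟩
    rintro (i | i) (j | j) h <;> simp only [s, Sum.elim_inl, Sum.elim_inr, Fin.mk.injEq] at h
    · exact congrArg _ (Fin.ext (by omega))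
    · omega
    · omega
    · exact congrArg _ (Fin.ext (by omega))
  let er := Equiv.ofBijective r hr
  let es := Equiv.ofBijective s hs
  let σ : Equiv.Perm (Fin (N + 1) ⊕ Fin (N + 1)) := es.trans er.symm
  let ε : F := ((Equiv.Perm.sign σ : ℤˣ) : ℤ)
  have hε : ε * ε = 1 := by
    simp only [ε]
    rw [← Int.cast_mul, ← Units.val_mul, Int.units_mul_self]
    simp
  refine ⟨ε * ((-1) ^ N * ∏ j : Fin N, ((z j.castSucc)⁻¹ - 1)), ?_, fun m => ?_⟩
  · refine mul_ne_zero (fun h => by simp [h] at hε) (mul_ne_zero (by simp) ?_)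
    refine Finset.prod_ne_zero_iff.mpr fun j _ h => hz1 j.castSucc ?_
    rw [← inv_inv (z j.castSucc), sub_eq_zero.mp h, inv_one]
  set M : Matrix (Fin (2 * (N + 1))) (Fin (2 * (N + 1))) F := of fun i j =>
    ζ j ^ ((if (i : ℕ) < N + 1 then (m : ℤ) else 0) + ((2 * (N + 1) : ℕ) : ℤ) - 1 - (i : ℕ)) with hM
  have h1 : (M.submatrix er es).det = ε * M.det := by
    have : M.submatrix er es = (M.submatrix er er).submatrix id σ := by
      ext i j
      simp [σ]
    rw [this, det_permute', det_submatrix_equiv_self]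
  have h2 : M.det = ε * (M.submatrix er es).det := by
    rw [h1, ← mul_assoc, hε, one_mul]
  let z' : Fin (N + 1) → F := fun j => ζ ⟨2 * j + 1, by omega⟩
  have h3 : M.submatrix er es =
      fromBlocks (of fun i j : Fin (N + 1) => z j ^ (m + 1 + 2 * N - (i : ℕ)))
      (of fun i j : Fin (N + 1) => z' j ^ (m + 1 + 2 * N - (i : ℕ)))
      (of fun i j : Fin (N + 1) => z j ^ (i : ℕ))
      (of fun i j : Fin (N + 1) => z' j ^ (i : ℕ)) := by
    have q1 : ∀ i : Fin (N + 1), (m : ℤ) + ((2 * (N + 1) : ℕ) : ℤ) - 1 - ((i : ℕ) : ℤ) =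
        ((m + 1 + 2 * N - (i : ℕ) : ℕ) : ℤ) := fun i => by omega
    have q2 : ∀ i : Fin (N + 1), (0 : ℤ) + ((2 * (N + 1) : ℕ) : ℤ) - 1 -
        ((2 * N + 1 - (i : ℕ) : ℕ) : ℤ) = ((i : ℕ) : ℤ) := fun i => by omega
    have q3 : ∀ i : Fin (N + 1), ¬ 2 * N + 1 - (i : ℕ) < N + 1 := fun i => by omega
    ext (i | i) (j | j)
    · simp only [hM, er, es, r, s, submatrix_apply, of_apply, Equiv.ofBijective_apply,
        Sum.elim_inl, fromBlocks_apply₁₁, he, i.isLt, if_true, q1, zpow_natCast]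
    · simp only [hM, er, es, r, s, submatrix_apply, of_apply, Equiv.ofBijective_apply,
        Sum.elim_inl, Sum.elim_inr, fromBlocks_apply₁₂, i.isLt, if_true, q1, zpow_natCast, z']
    · simp only [hM, er, es, r, s, submatrix_apply, of_apply, Equiv.ofBijective_apply,
        Sum.elim_inl, Sum.elim_inr, fromBlocks_apply₂₁, he, q3, if_false, q2, zpow_natCast]
    · simp only [hM, er, es, r, s, submatrix_apply, of_apply, Equiv.ofBijective_apply,
        Sum.elim_inr, fromBlocks_apply₂₂, q3, if_false, q2, zpow_natCast, z']
  rw [h2, h3, det_fromBlocks_pairs (by omega) z hz z' ho hl]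
  have h4 : det (of fun i j : Fin (N + 1) => z j ^ (m + 1 + 2 * N - (i : ℕ)) - z j ^ (i : ℕ)) =
      pairAlt (fun j => z j ^ (m + 1 + N)) z := by
    unfold pairAlt
    congr 1
    ext i j
    simp only [of_apply, ← pow_add]
    congr 2
    omega
  rw [h4]
  ring

theorem gen_ne {n : ℕ} {i : Fin n} {r : MvPolynomial (Fin n) ℚ}
    (v : Fin n → ℚ) (h : v i ≠ MvPolynomial.eval v r) :
    gen n i ≠ algebraMap (MvPolynomial (Fin n) ℚ) (FF n) r := fun e => h (by
  have := IsFractionRing.injective (MvPolynomial (Fin n) ℚ) (FF n) e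
  simpa using congrArg (MvPolynomial.eval v) this)

theorem gen_mul_gen_ne_one {n : ℕ} (i j : Fin n) : gen n i * gen n j ≠ 1 := fun e => by
  unfold gen at e
  rw [← map_mul, ← map_one (algebraMap (MvPolynomial (Fin n) ℚ) (FF n))] at e
  have := IsFractionRing.injective (MvPolynomial (Fin n) ℚ) (FF n) e
  simpa using congrArg (MvPolynomial.eval fun _ => (0 : ℚ)) this

theorem gen_ne_gen {n : ℕ} {i j : Fin n} (h : i ≠ j) : gen n i ≠ gen n j := by
  refine gen_ne (Pi.single i 1) ?_
  simp [Ne.symm h]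

theorem gen_ne_intCast {n : ℕ} (i : Fin n) (a : ℤ) : gen n i ≠ a := by
  have := gen_ne (i := i) (r := (a : MvPolynomial (Fin n) ℚ)) (fun _ => (a : ℚ) + 1) (by simp)
  simpa using this

/-- **Corollary.**  For `n ≥ 1` and a nonnegative integer `m`, the Schur function of rectangular
shape `(m^n)` in the `2n` variables `(x_1, x_1^{-1}, …, x_{n-1}, x_{n-1}^{-1}, x_n, 1)` equals
the sum of the intermediate symplectic characters `sp^{(n-1,1)}_λ(x_1,…,x_{n-1} | x_n)` over all
partitions `λ ⊆ (m^n)`, as an identity in `ℚ(x_1, …, x_n)`.  Here `gen n i` plays the role of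
`x_i`. -/
theorem schur_rectangle_eq_sum_spInter (n m : ℕ) (hn : 1 ≤ n) :
    schurP
      (fun j : Fin (2 * n) =>
        if h : (j : ℕ) = 2 * n - 1 then (1 : FF n)
        else if (j : ℕ) % 2 = 0 then gen n ⟨(j : ℕ) / 2, by have := j.isLt; omega⟩
        else (gen n ⟨(j : ℕ) / 2, by have := j.isLt; omega⟩)⁻¹)
      (fun j => if (j : ℕ) < n then (m : ℤ) else 0) =
    ∑ lam ∈ Finset.univ.filter
        (fun lam : Fin n → Fin (m + 1) => Antitone fun i => (lam i : ℕ)),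
      spInterP (n - 1) (gen n) (fun i => ((lam i : ℕ) : ℤ)) := by
  obtain ⟨N, rfl⟩ : ∃ N, n = N + 1 := ⟨n - 1, by omega⟩
  have g0 : ∀ j, gen (N + 1) j ≠ 0 := fun j => by simpa using gen_ne_intCast j 0
  have g1 : ∀ j, gen (N + 1) j ≠ 1 := fun j => by simpa using gen_ne_intCast j 1
  have g2 : ∀ j, gen (N + 1) j ≠ -1 := fun j => by simpa using gen_ne_intCast j (-1)
  obtain ⟨κ, hκ, hA⟩ := sum_det_interMatP (gen (N + 1)) g0 g1 g2
    (fun i j h => gen_ne_gen h) (fun i j _ => gen_mul_gen_ne_one i j)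
  have hS := exists_rectangle_alternant (gen (N + 1)) g0 g1
    (fun j : Fin (2 * (N + 1)) =>
        if h : (j : ℕ) = 2 * (N + 1) - 1 then (1 : FF (N + 1))
        else if (j : ℕ) % 2 = 0 then gen (N + 1) ⟨(j : ℕ) / 2, by have := j.isLt; omega⟩
        else (gen (N + 1) ⟨(j : ℕ) / 2, by have := j.isLt; omega⟩)⁻¹)
    (fun j => by
      rw [dif_neg (by simp only; omega), if_pos (by simp only; omega)]
      congr 1
      ext
      simp only
      omega)
    (fun j => by
      rw [dif_neg (by simp only; omega), if_neg (by simp only; omega)]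
      congr 2
      ext
      simp only [Fin.val_castSucc]
      omega)
    (by rw [dif_pos (by simp only; omega)])
  obtain ⟨c, hc, hS⟩ := hS
  have hS0 := hS 0
  simp only [Nat.cast_zero, ite_self, zero_add] at hS0
  have hb : boxPartitions (N + 1) 1 = {fun _ => 0} := by
    ext lam
    simp only [mem_boxPartitions, Nat.lt_one_iff, Finset.mem_singleton, funext_iff]
    exact ⟨fun h => h.1, fun h => ⟨h, fun i j _ => by rw [h i, h j]⟩⟩
  have hA1 := hA 1 le_rfl
  rw [hb, Finset.sum_singleton] at hA1
  simp only [Nat.cast_zero] at hA1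
  unfold schurP
  rw [hS m, hS0, mul_div_mul_left _ _ hc]
  unfold spInterP
  rw [← Finset.sum_div, Nat.add_sub_cancel,
    sum_filter_antitone_fin (fun lam => (interMatP N (gen (N + 1)) fun i => (lam i : ℤ)).det),
    hA (m + 1) (by omega), hA1, mul_div_mul_left _ _ hκ]
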